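/- Let w₁, w₂ : ℝ² → Matrix (Fin 2) (Fin 2) ℂ be smooth in the variables (x₁, x₂). Set Q := diagonal(1, −1), K := w₁Q − Qw₁, and for λ ∈ ℂ define B₁(λ) := λQ + K and B₂(λ) := λ²Q + λK + (w₂Q − Qw₂) − K·w₁. Assume the zero-curvature equation ∂_{x₂}B₁(λ) − ∂_{x₁}B₂(λ) + B₁(λ)B₂(λ) − B₂(λ)B₁(λ) = 0 holds at every point for every λ ∈ ℂ. Then the entries u := (w₁)₁₂ and v := (w₁)₂₁ satisfy the coupled nonlinear Schrödinger system 2·∂_{x₂}u = ∂²_{x₁}u + 8u²v and −2·∂_{x₂}v = ∂²_{x₁}v + 8v²u. -/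

import Mathlib

/-- Partial derivative of a matrix-valued function on `ℝ²` with respect to
coordinate `u`, taken entrywise. Coordinates: `0 = x₁`, `1 = x₂`. -/
noncomputable def pd (u : Fin 2) (A : (Fin 2 → ℝ) → Matrix (Fin 2) (Fin 2) ℂ)
    (p : Fin 2 → ℝ) : Matrix (Fin 2) (Fin 2) ℂ :=
  Matrix.of fun i j => deriv (fun t => A (Function.update p u t) i j) (p u)

/-- Partial derivative of a scalar function on `ℝ²`. -/
noncomputable def pds (u : Fin 2) (f : (Fin 2 → ℝ) → ℂ) (p : Fin 2 → ℝ) : ℂ :=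
  deriv (fun t => f (Function.update p u t)) (p u)

/-- All matrix entries are `C^∞`. -/
def IsSmoothMat (A : (Fin 2 → ℝ) → Matrix (Fin 2) (Fin 2) ℂ) : Prop :=
  ∀ i j, ContDiff ℝ (⊤ : ℕ∞) fun p => A p i j

theorem differentiableAt_comp_update {f : (Fin 2 → ℝ) → ℂ} (hf : ContDiff ℝ (⊤ : ℕ∞) f)
    (i : Fin 2) (p : Fin 2 → ℝ) (s : ℝ) :
    DifferentiableAt ℝ (fun t => f (Function.update p i t)) s :=
  ((hf.differentiable (by simp)) _).comp s (hasDerivAt_update p i s).differentiableAt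

theorem pds_const_mul (i : Fin 2) (c : ℂ) (f : (Fin 2 → ℝ) → ℂ) (p : Fin 2 → ℝ) :
    pds i (fun q => c * f q) p = c * pds i f p :=
  deriv_const_mul_field c

theorem pds_add {f g : (Fin 2 → ℝ) → ℂ} (hf : ContDiff ℝ (⊤ : ℕ∞) f)
    (hg : ContDiff ℝ (⊤ : ℕ∞) g) (i : Fin 2) (p : Fin 2 → ℝ) :
    pds i (fun q => f q + g q) p = pds i f p + pds i g p :=
  deriv_fun_add (differentiableAt_comp_update hf i p _) (differentiableAt_comp_update hg i p _)

/-- An equation affine in the spectral parameter `lam`, with coefficients built from `f` and an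
auxiliary function `m`, forces `m = -∂₀ f` and hence a second order evolution equation for `f`. -/
theorem pds_pds_of_affine {f m : (Fin 2 → ℝ) → ℂ} (hf : ContDiff ℝ (⊤ : ℕ∞) f)
    (hm : ContDiff ℝ (⊤ : ℕ∞) m) {c : ℂ} (hc : c ≠ 0) (r : (Fin 2 → ℝ) → ℂ)
    (h : ∀ (lam : ℂ) p, pds 1 (fun q => c * f q) p - pds 0 (fun q => lam * (c * f q) + m q) p
      - lam * (c * m p) + r p = 0) (p : Fin 2 → ℝ) :
    c * pds 1 f p + pds 0 (pds 0 f) p + r p = 0 := by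
  have hsplit (lam : ℂ) (q : Fin 2 → ℝ) :
      c * pds 1 f q - (lam * (c * pds 0 f q) + pds 0 m q) - lam * (c * m q) + r q = 0 := by
    have hlin := h lam q
    rwa [pds_add (contDiff_const.mul (contDiff_const.mul hf)) hm, pds_const_mul, pds_const_mul,
      pds_const_mul] at hlin
  have hmf : m = fun q => (-1) * pds 0 f q := by
    funext q
    apply mul_left_cancel₀ hc
    linear_combination hsplit 0 q - hsplit 1 q
  have hm' : pds 0 m p = (-1) * pds 0 (pds 0 f) p := by
    rw [hmf, pds_const_mul]
  linear_combination hsplit 0 p + hm'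

/-- The zero-curvature equation for `B₁(λ), B₂(λ)` implies the coupled NLS system for
`u = (w₁)₁₂` and `v = (w₁)₂₁`. -/
theorem stmt4
    (w1 w2 : (Fin 2 → ℝ) → Matrix (Fin 2) (Fin 2) ℂ)
    (hw1 : IsSmoothMat w1) (hw2 : IsSmoothMat w2)
    (Q : Matrix (Fin 2) (Fin 2) ℂ) (hQ : Q = Matrix.diagonal ![1, -1])
    (K : (Fin 2 → ℝ) → Matrix (Fin 2) (Fin 2) ℂ)
    (hK : ∀ p, K p = w1 p * Q - Q * w1 p)
    (B1 B2 : ℂ → (Fin 2 → ℝ) → Matrix (Fin 2) (Fin 2) ℂ)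
    (hB1 : ∀ lam p, B1 lam p = lam • Q + K p)
    (hB2 : ∀ lam p, B2 lam p = (lam ^ 2) • Q + lam • K p
      + (w2 p * Q - Q * w2 p) - K p * w1 p)
    (hzc : ∀ lam p, pd 1 (B1 lam) p - pd 0 (B2 lam) p
      + B1 lam p * B2 lam p - B2 lam p * B1 lam p = 0)
    (u v : (Fin 2 → ℝ) → ℂ)
    (hu : ∀ p, u p = w1 p 0 1) (hv : ∀ p, v p = w1 p 1 0) :
    ∀ p, 2 * pds 1 u p = pds 0 (pds 0 u) p + 8 * (u p) ^ 2 * v p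
      ∧ -2 * pds 1 v p = pds 0 (pds 0 v) p + 8 * (v p) ^ 2 * u p := by
  obtain rfl : u = fun p => w1 p 0 1 := funext hu
  obtain rfl : v = fun p => w1 p 1 0 := funext hv
  have hM01 : ContDiff ℝ (⊤ : ℕ∞) fun p => -2 * w2 p 0 1 + 2 * (w1 p 0 1 * w1 p 1 1) :=
    (contDiff_const.mul (hw2 0 1)).add (contDiff_const.mul ((hw1 0 1).mul (hw1 1 1)))
  have hM10 : ContDiff ℝ (⊤ : ℕ∞) fun p => 2 * w2 p 1 0 + -2 * (w1 p 1 0 * w1 p 0 0) :=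
    (contDiff_const.mul (hw2 1 0)).add (contDiff_const.mul ((hw1 1 0).mul (hw1 0 0)))
  have e1 (lam : ℂ) (p) : B1 lam p = !![lam, -2 * w1 p 0 1; 2 * w1 p 1 0, -lam] := by
    rw [hB1, hK, hQ]
    ext i j
    fin_cases i <;> fin_cases j <;> simp [Matrix.mul_apply, Fin.sum_univ_two] <;> ring
  have e2 (lam : ℂ) (p) : B2 lam p =
      !![lam ^ 2 + 2 * w1 p 0 1 * w1 p 1 0,
          lam * (-2 * w1 p 0 1) + (-2 * w2 p 0 1 + 2 * (w1 p 0 1 * w1 p 1 1));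
        lam * (2 * w1 p 1 0) + (2 * w2 p 1 0 + -2 * (w1 p 1 0 * w1 p 0 0)),
          -lam ^ 2 - 2 * w1 p 0 1 * w1 p 1 0] := by
    rw [hB2, hK, hQ]
    ext i j
    fin_cases i <;> fin_cases j <;>
      simp [Matrix.mul_apply, Fin.sum_univ_two] <;> ring
  intro p
  constructor
  · have key := pds_pds_of_affine (hw1 0 1) hM01 (c := -2) (by norm_num)
      (fun p => 8 * w1 p 0 1 ^ 2 * w1 p 1 0) (fun lam p => by
        have h := congrFun (congrFun (hzc lam p) 0) 1
        simp only [Matrix.add_apply, Matrix.sub_apply, Matrix.mul_apply, Fin.sum_univ_two, pd,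
          Matrix.of_apply, Matrix.zero_apply, e1, e2, Matrix.cons_val', Matrix.cons_val_zero,
          Matrix.cons_val_one, Matrix.cons_val_fin_one] at h
        simp only [pds]
        linear_combination h) p
    linear_combination -key
  · have key := pds_pds_of_affine (hw1 1 0) hM10 (c := 2) (by norm_num)
      (fun p => 8 * w1 p 1 0 ^ 2 * w1 p 0 1) (fun lam p => by
        have h := congrFun (congrFun (hzc lam p) 1) 0
        simp only [Matrix.add_apply, Matrix.sub_apply, Matrix.mul_apply, Fin.sum_univ_two, pd,
          Matrix.of_apply, Matrix.zero_apply, e1, e2, Matrix.cons_val', Matrix.cons_val_zero,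
          Matrix.cons_val_one, Matrix.cons_val_fin_one] at h
        simp only [pds]
        linear_combination h) p
    linear_combination -key
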